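/- arXiv:2109.08392 — 2 statements merged into one kernel-verified Lean document; each statement's English description precedes it below -/
import Mathlib

section
/- Let r be a real number and let n ≥ 1 be an integer with n < r. Then lim_{z → −n} (z + n)·Γ(z+1)·(z+r)^{−z−1/2}·e^{z+r} = (−1)^{n+1}·e^{r−n}·(r−n)^{n−1/2}/(n−1)!, where the limit is taken over complex z → −n and w^u denotes the principal branch exp(u·log w). (That is, the residue at z = −n of the function Γ(z+1)·(z+r)^{−z−1/2}·e^{z+r} equals Spouge's coefficient c_n.) -/
open Filter Topology in
theorem gamma_res_aux (k : ℕ) : Tendsto (fun z : ℂ => (z + ((k : ℂ) + 1)) * Complex.Gamma (z + 1))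
    (𝓝[≠] (-((k : ℂ) + 1))) (𝓝 ((-1) ^ k / (k.factorial : ℂ))) := by
  have shift : ∀ a : ℂ, Tendsto (fun z : ℂ => z + 1) (𝓝[≠] a) (𝓝[≠] (a + 1)) := by
    intro a
    refine tendsto_nhdsWithin_iff.2 ⟨?_, ?_⟩
    · exact ((continuous_id.add continuous_const).tendsto a).mono_left nhdsWithin_le_nhds
    · filter_upwards [self_mem_nhdsWithin] with z hz
      simpa using hz
  induction k with
  | zero =>
    have h := shift (-1)
    rw [neg_add_cancel] at h
    simpa [Function.comp_def] using Complex.tendsto_self_mul_Gamma_nhds_zero.comp h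
  | succ k ih =>
    have hk : (k : ℂ) + 1 ≠ 0 := Nat.cast_add_one_ne_zero k
    have h := shift (-((k : ℂ) + 1 + 1))
    rw [show -((k : ℂ) + 1 + 1) + 1 = -((k : ℂ) + 1) by ring] at h
    have hne : -((k : ℂ) + 1) ≠ 0 := neg_ne_zero.2 hk
    have h1 := (ih.comp h).div (h.mono_right nhdsWithin_le_nhds) hne
    push_cast
    have he : (-1 : ℂ) ^ (k + 1) / ((k + 1).factorial : ℂ)
        = (-1) ^ k / (k.factorial : ℂ) / (-((k : ℂ) + 1)) := by
      have : (k.factorial : ℂ) ≠ 0 := by exact_mod_cast k.factorial_ne_zero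
      rw [Nat.factorial_succ]
      push_cast
      field_simp
      ring
    rw [he]
    refine h1.congr' ?_
    have h2 : ∀ᶠ z : ℂ in 𝓝[≠] (-((k : ℂ) + 1 + 1)), z + 1 ≠ 0 :=
      (h.mono_right nhdsWithin_le_nhds).eventually_ne hne
    filter_upwards [h2] with z hz
    show (z + 1 + ((k : ℂ) + 1)) * Complex.Gamma (z + 1 + 1) / (z + 1) =
      (z + ((k : ℂ) + 1 + 1)) * Complex.Gamma (z + 1)
    rw [Complex.Gamma_add_one (z + 1) hz]
    field_simp
    ring

/-- Spouge's coefficient as a residue: for real `r` and an integer `1 ≤ n < r`,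
`lim_{z → −n} (z + n)·Γ(z+1)·(z+r)^{−z−1/2}·e^{z+r}
  = (−1)^{n+1}·e^{r−n}·(r−n)^{n−1/2}/(n−1)!`,
where the limit is over complex `z → −n` (punctured neighborhood) and the complex
power is the principal branch. -/
theorem spouge_coefficient_residue (r : ℝ) (n : ℕ) (hn : 1 ≤ n) (hr : (n : ℝ) < r) :
    Filter.Tendsto
      (fun z : ℂ => (z + (n : ℂ)) * Complex.Gamma (z + 1) *
        (z + (r : ℂ)) ^ (-z - 1 / 2) * Complex.exp (z + (r : ℂ)))
      (nhdsWithin (-(n : ℂ)) {(-(n : ℂ))}ᶜ)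
      (nhds (((-1) ^ (n + 1) : ℂ) * (Real.exp (r - n) : ℂ) *
        (((r - n) ^ ((n : ℝ) - 1 / 2) : ℝ) : ℂ) / ((n - 1).factorial : ℂ))) := by
  obtain ⟨k, rfl⟩ : ∃ k, n = k + 1 := ⟨n - 1, by omega⟩
  have hg := gamma_res_aux k
  have hpos : 0 < r - ((k + 1 : ℕ) : ℝ) := sub_pos.2 hr
  have hb : -((k + 1 : ℕ) : ℂ) + (r : ℂ) = ((r - ((k + 1 : ℕ) : ℝ) : ℝ) : ℂ) := by
    push_cast
    ring
  have hc : ContinuousAt (fun z : ℂ => (z + (r : ℂ)) ^ (-z - 1 / 2)) (-((k + 1 : ℕ) : ℂ)) := by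
    refine ContinuousAt.cpow (by fun_prop) (by fun_prop) ?_
    rw [hb]
    exact Complex.ofReal_mem_slitPlane.2 hpos
  have hE : ContinuousAt (fun z : ℂ => Complex.exp (z + (r : ℂ))) (-((k + 1 : ℕ) : ℂ)) := by
    fun_prop
  have hc' := hc.tendsto.mono_left (nhdsWithin_le_nhds (s := {(-((k + 1 : ℕ) : ℂ))}ᶜ))
  have hE' := hE.tendsto.mono_left (nhdsWithin_le_nhds (s := {(-((k + 1 : ℕ) : ℂ))}ᶜ))
  rw [← Nat.cast_add_one] at hg
  have key := (hg.mul hc').mul hE'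
  convert key using 2
  rw [hb, Complex.ofReal_cpow hpos.le, Complex.ofReal_exp, Nat.add_sub_cancel]
  have hx : (((((k + 1 : ℕ) : ℝ) - 1 / 2 : ℝ)) : ℂ) = - -((k + 1 : ℕ) : ℂ) - 1 / 2 := by
    push_cast
    ring
  rw [hx]
  ring
end

section
/- For every complex number z with 0 ≤ Re(z) < 1 and Im(z) > 1, one has log(sin(πz)) = log((1 − e^{2πiz})/2) − iπ·(z − 1/2), where log denotes the principal branch of the complex logarithm. -/
/-- For complex `z` with `0 ≤ Re(z) < 1` and `Im(z) > 1`,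
`log(sin(πz)) = log((1 − e^{2πiz})/2) − iπ·(z − 1/2)`,
with the principal branch of the complex logarithm. -/
theorem log_sin_pi_upper (z : ℂ) (h1 : 0 ≤ z.re) (h2 : z.re < 1) (h3 : 1 < z.im) :
    Complex.log (Complex.sin ((Real.pi : ℂ) * z)) =
      Complex.log ((1 - Complex.exp (2 * (Real.pi : ℂ) * Complex.I * z)) / 2)
        - Complex.I * (Real.pi : ℂ) * (z - 1 / 2) := by
  have hpi := Real.pi_pos
  have hn : ‖Complex.exp (2 * (Real.pi : ℂ) * Complex.I * z)‖ < 1 := by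
    rw [Complex.norm_exp, Real.exp_lt_one_iff]
    simp
    positivity
  have hre : 0 < ((1 - Complex.exp (2 * (Real.pi : ℂ) * Complex.I * z)) / 2).re := by
    have := Complex.re_le_norm (Complex.exp (2 * (Real.pi : ℂ) * Complex.I * z))
    rw [Complex.div_ofNat_re, Complex.sub_re, Complex.one_re]
    linarith
  have hne : (1 - Complex.exp (2 * (Real.pi : ℂ) * Complex.I * z)) / 2 ≠ 0 := by
    intro h
    rw [h] at hre
    simp at hre
  have harg := abs_lt.1 (Complex.abs_arg_lt_pi_div_two_iff.2 (Or.inl hre))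
  have him : (Complex.log ((1 - Complex.exp (2 * (Real.pi : ℂ) * Complex.I * z)) / 2)
        - Complex.I * (Real.pi : ℂ) * (z - 1 / 2)).im =
      Complex.arg ((1 - Complex.exp (2 * (Real.pi : ℂ) * Complex.I * z)) / 2)
        - Real.pi * (z.re - 1 / 2) := by
    rw [Complex.sub_im, Complex.log_im]
    simp
  have hsin : Complex.sin ((Real.pi : ℂ) * z) = Complex.exp
      (Complex.log ((1 - Complex.exp (2 * (Real.pi : ℂ) * Complex.I * z)) / 2)
        - Complex.I * (Real.pi : ℂ) * (z - 1 / 2)) := by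
    have e1 : Complex.exp (-(Complex.I * (Real.pi : ℂ) * (z - 1 / 2))) =
        Complex.exp (-((Real.pi : ℂ) * z) * Complex.I) * Complex.I := by
      have e0 : -(Complex.I * (Real.pi : ℂ) * (z - 1 / 2)) =
          -((Real.pi : ℂ) * z) * Complex.I + (Real.pi : ℂ) / 2 * Complex.I := by ring
      rw [e0, Complex.exp_add, Complex.exp_pi_div_two_mul_I]
    have e2 : Complex.exp (2 * (Real.pi : ℂ) * Complex.I * z) *
        Complex.exp (-((Real.pi : ℂ) * z) * Complex.I) =
        Complex.exp ((Real.pi : ℂ) * z * Complex.I) := by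
      rw [← Complex.exp_add]
      congr 1
      ring
    rw [sub_eq_add_neg (Complex.log _), Complex.exp_add, Complex.exp_log hne, e1, Complex.sin, ← e2]
    ring
  rw [hsin, Complex.log_exp]
  · rw [him]
    nlinarith
  · rw [him]
    nlinarith
end
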